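/- arXiv:1306.4286 — 5 statements merged into one kernel-verified Lean document; each statement's English description precedes it below -/
import Mathlib

section
/- Let p be a prime and E a finite group of order p² in which every element satisfies x^p = 1 and any two elements commute (i.e., E is elementary abelian of order p²). Let f : E → E be a group homomorphism and let A₁, A₂, A₃ be three pairwise distinct subgroups of E of order p such that f(Aᵢ) ⊆ Aᵢ for i = 1, 2, 3. Then there exists a natural number λ with 0 ≤ λ < p such that f(x) = x^λ for all x ∈ E. -/
namespace Subgroup

variable {G : Type*} [Group G] {p : ℕ}

theorem exists_pow_eq_of_card_eq_prime (hp : p.Prime) {A : Subgroup G} (hA : Nat.card A = p)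
    {a x : G} (ha : a ∈ A) (ha1 : a ≠ 1) (hx : x ∈ A) : ∃ k : ℕ, a ^ k = x := by
  have := Fact.mk hp
  have hne : (⟨a, ha⟩ : A) ≠ 1 := fun h => ha1 (congrArg Subtype.val h)
  obtain ⟨k, hk⟩ := mem_powers_of_prime_card (g' := (⟨x, hx⟩ : A)) hA hne
  exact ⟨k, congrArg Subtype.val hk⟩

theorem le_of_card_eq_prime_of_mem (hp : p.Prime) {A B : Subgroup G} (hA : Nat.card A = p)
    {a : G} (ha : a ∈ A) (ha1 : a ≠ 1) (haB : a ∈ B) : A ≤ B := by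
  intro x hx
  obtain ⟨k, rfl⟩ := exists_pow_eq_of_card_eq_prime hp hA ha ha1 hx
  exact B.pow_mem haB k

theorem eq_one_of_mem_of_mem_of_card_eq_prime (hp : p.Prime) {A B : Subgroup G}
    (hA : Nat.card A = p) (hB : Nat.card B = p) (hAB : A ≠ B) {a : G} (ha : a ∈ A)
    (haB : a ∈ B) : a = 1 := by
  by_contra ha1
  exact hAB (le_antisymm (le_of_card_eq_prime_of_mem hp hA ha ha1 haB)
    (le_of_card_eq_prime_of_mem hp hB haB ha1 ha))

theorem map_eq_pow_of_card_eq_prime (hp : p.Prime) {A : Subgroup G} (hA : Nat.card A = p)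
    (f : G →* G) {a : G} {k : ℕ} (ha : a ∈ A) (ha1 : a ≠ 1) (hfa : f a = a ^ k) {x : G}
    (hx : x ∈ A) : f x = x ^ k := by
  obtain ⟨n, rfl⟩ := exists_pow_eq_of_card_eq_prime hp hA ha ha1 hx
  rw [map_pow, hfa, pow_right_comm]

end Subgroup


theorem stmt4 {E : Type*} [Group E] [Finite E] (p : ℕ) (hp : p.Prime)
    (hcard : Nat.card E = p ^ 2) (hexp : ∀ x : E, x ^ p = 1)
    (hcomm : ∀ x y : E, x * y = y * x)
    (f : E →* E) (A₁ A₂ A₃ : Subgroup E)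
    (h12 : A₁ ≠ A₂) (h13 : A₁ ≠ A₃) (h23 : A₂ ≠ A₃)
    (hc1 : Nat.card A₁ = p) (hc2 : Nat.card A₂ = p) (hc3 : Nat.card A₃ = p)
    (hf1 : ∀ x ∈ A₁, f x ∈ A₁) (hf2 : ∀ x ∈ A₂, f x ∈ A₂)
    (hf3 : ∀ x ∈ A₃, f x ∈ A₃) :
    ∃ lam : ℕ, lam < p ∧ ∀ x : E, f x = x ^ lam := by
  have hdisj : Disjoint A₁ A₂ := Subgroup.disjoint_def.2 fun h₁ h₂ =>
    Subgroup.eq_one_of_mem_of_mem_of_card_eq_prime hp hc1 hc2 h12 h₁ h₂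
  have hcompl : Subgroup.IsComplement' A₁ A₂ :=
    Subgroup.isComplement'_of_card_mul_and_disjoint (by rw [hc1, hc2, hcard, sq]) hdisj
  have hprod (x : E) : ∃ a ∈ A₁, ∃ b ∈ A₂, a * b = x := by
    obtain ⟨⟨a, b⟩, h⟩ := hcompl.2 x
    exact ⟨a, a.2, b, b.2, h⟩
  obtain ⟨c, hc, hc_ne⟩ : ∃ c ∈ A₃, c ≠ 1 := by
    refine A₃.ne_bot_iff_exists_ne_one.1 ?_ |>.elim fun c h =>
      ⟨c, c.2, fun h' => h (Subtype.ext h')⟩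
    rintro rfl
    exact hp.ne_one (hc3 ▸ Subgroup.card_bot)
  obtain ⟨k, hk⟩ := Subgroup.exists_pow_eq_of_card_eq_prime hp hc3 hc hc_ne (hf3 c hc)
  obtain ⟨a, ha, b, hb, rfl⟩ := hprod c
  have ha_ne : a ≠ 1 := by
    rintro rfl
    exact hc_ne (Subgroup.eq_one_of_mem_of_mem_of_card_eq_prime hp hc2 hc3 h23
      (by simpa using hb) hc)
  have hb_ne : b ≠ 1 := by
    rintro rfl
    exact hc_ne (Subgroup.eq_one_of_mem_of_mem_of_card_eq_prime hp hc1 hc3 h13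
      (by simpa using ha) hc)
  have hmul (x y : E) (n : ℕ) : (x * y) ^ n = x ^ n * y ^ n := Commute.mul_pow (hcomm x y) n
  rw [hmul, map_mul] at hk
  have hinj := Subgroup.mul_injective_of_disjoint hdisj
  have hpair := @hinj (⟨a ^ k, A₁.pow_mem ha k⟩, ⟨b ^ k, A₂.pow_mem hb k⟩)
    (⟨f a, hf1 a ha⟩, ⟨f b, hf2 b hb⟩) hk
  simp only [Prod.mk.injEq, Subtype.mk.injEq] at hpair
  refine ⟨k % p, Nat.mod_lt _ hp.pos, fun x => ?_⟩
  rw [← pow_eq_pow_mod k (hexp x)]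
  obtain ⟨y, hy, z, hz, rfl⟩ := hprod x
  rw [map_mul, hmul, Subgroup.map_eq_pow_of_card_eq_prime hp hc1 f ha ha_ne hpair.1.symm hy,
    Subgroup.map_eq_pow_of_card_eq_prime hp hc2 f hb hb_ne hpair.2.symm hz]
end

section
/- Let p be a prime, G a finite p-group, and 𝒞 a *-covering of G. Suppose A and B are two distinct subgroups of G of order p, C ∈ 𝒞 is a cell containing both A and B, and there exist C₁, C₂, C₃ ∈ 𝒞 such that C ∩ C₁, C ∩ C₂ and C ∩ C₃ are three pairwise distinct subgroups of order p. Then for every f ∈ R_𝒞(G) there exists a natural number λ with 0 ≤ λ < p such that f(x) = x^λ for all x ∈ C. -/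
/-- A cover of a group `G`: a set of subgroups whose union is all of `G`. -/
def IsCover {G : Type*} [Group G] (𝒞 : Set (Subgroup G)) : Prop :=
  ∀ g : G, ∃ C ∈ 𝒞, g ∈ C

/-- `C` is a maximal cyclic subgroup of `G`. -/
def IsMaximalCyclic {G : Type*} [Group G] (C : Subgroup G) : Prop :=
  IsCyclic C ∧ ∀ D : Subgroup G, IsCyclic D → C ≤ D → C = D

/-- `C` is elementary abelian of order `p ^ 2`. -/
def IsElemAbelianP2 {G : Type*} [Group G] (p : ℕ) (C : Subgroup G) : Prop :=
  Nat.card C = p ^ 2 ∧ (∀ x ∈ C, x ^ p = 1) ∧ ∀ x ∈ C, ∀ y ∈ C, x * y = y * x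

/-- A `*`-covering: a cover all of whose cells are maximal cyclic subgroups or
elementary abelian subgroups of order `p ^ 2`. -/
def IsStarCover {G : Type*} [Group G] (p : ℕ) (𝒞 : Set (Subgroup G)) : Prop :=
  IsCover 𝒞 ∧ ∀ C ∈ 𝒞, IsMaximalCyclic C ∨ IsElemAbelianP2 p C

/-- Membership in the ring `R_𝒞(G)`: `f` maps each cell into itself and is
multiplicative on each cell. -/
def InRC {G : Type*} [Group G] (𝒞 : Set (Subgroup G)) (f : G → G) : Prop :=
  ∀ C ∈ 𝒞, (∀ x ∈ C, f x ∈ C) ∧ ∀ u ∈ C, ∀ v ∈ C, f (u * v) = f u * f v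

/-- An operation that preserves a subgroup of prime order and is multiplicative on it acts there
as a power map. -/
theorem exists_zpow_of_prime_card {G : Type*} [Group G] {p : ℕ} (hp : p.Prime) {P : Subgroup G}
    (hP : Nat.card P = p) {f : G → G} (hf : ∀ x ∈ P, f x ∈ P)
    (hmul : ∀ u ∈ P, ∀ v ∈ P, f (u * v) = f u * f v) :
    ∃ k : ℤ, ∀ x ∈ P, f x = x ^ k := by
  have : Fact p.Prime := ⟨hp⟩
  have : IsCyclic P := isCyclic_of_prime_card hP
  let σ : P →* P := MonoidHom.mk' (fun x => ⟨f x, hf x x.2⟩)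
    fun u v => Subtype.ext (hmul u u.2 v v.2)
  obtain ⟨k, hk⟩ := MonoidHom.map_cyclic σ
  exact ⟨k, fun x hx => congrArg Subtype.val (hk ⟨x, hx⟩)⟩

/-- Distinct subgroups of the same prime order intersect trivially. -/
theorem disjoint_of_prime_card {G : Type*} [Group G] {p : ℕ} (hp : p.Prime) {P Q : Subgroup G}
    (hP : Nat.card P = p) (hQ : Nat.card Q = p) (hne : P ≠ Q) : Disjoint P Q := by
  have : Finite P := Nat.finite_of_card_ne_zero (hP ▸ hp.ne_zero)
  have : Finite Q := Nat.finite_of_card_ne_zero (hQ ▸ hp.ne_zero)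
  rw [disjoint_iff]
  have hdvd : Nat.card (P ⊓ Q : Subgroup G) ∣ p := hP ▸ Subgroup.card_dvd_of_le inf_le_left
  rcases (Nat.dvd_prime hp).1 hdvd with h | h
  · exact Subgroup.eq_bot_of_card_eq _ h
  · exact absurd ((Subgroup.eq_of_le_of_card_ge inf_le_left (by rw [hP, h])).symm.trans
      (Subgroup.eq_of_le_of_card_ge inf_le_right (by rw [hQ, h]))) hne

/-- In a group of prime order, a relation between powers of one nontrivial element holds for
every element. -/
theorem zpow_eq_zpow_of_prime_card {G : Type*} [Group G] {p : ℕ} (hp : p.Prime) {P : Subgroup G}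
    (hP : Nat.card P = p) {a x : G} (ha : a ∈ P) (ha1 : a ≠ 1) (hx : x ∈ P) {k m : ℤ}
    (h : a ^ k = a ^ m) : x ^ k = x ^ m := by
  have : Fact p.Prime := ⟨hp⟩
  obtain ⟨n, hn⟩ : (⟨x, hx⟩ : P) ∈ Subgroup.zpowers (⟨a, ha⟩ : P) :=
    mem_zpowers_of_prime_card hP fun h => ha1 (congrArg Subtype.val h)
  obtain rfl : a ^ n = x := congrArg Subtype.val hn
  rw [zpow_comm, h, zpow_comm]

/-- A group of order `p ^ 2` is the product of any two distinct subgroups of order `p`. -/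
theorem exists_mul_eq_of_card_sq {G : Type*} [Group G] {p : ℕ} (hp : p.Prime) {P Q C : Subgroup G}
    (hP : Nat.card P = p) (hQ : Nat.card Q = p) (hC : Nat.card C = p ^ 2)
    (hPC : P ≤ C) (hQC : Q ≤ C) (hne : P ≠ Q) {x : G} (hx : x ∈ C) :
    ∃ a ∈ P, ∃ b ∈ Q, a * b = x := by
  have : Finite C := Nat.finite_of_card_ne_zero (hC ▸ pow_ne_zero 2 hp.ne_zero)
  have hcompl : Subgroup.IsComplement' (P.subgroupOf C) (Q.subgroupOf C) := by
    refine Subgroup.isComplement'_of_card_mul_and_disjoint ?_ ?_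
    · rw [Nat.card_congr (Subgroup.subgroupOfEquivOfLe hPC).toEquiv,
        Nat.card_congr (Subgroup.subgroupOfEquivOfLe hQC).toEquiv, hP, hQ, hC, sq]
    · have h := disjoint_of_prime_card hp hP hQ hne
      rw [Subgroup.disjoint_def] at h ⊢
      exact fun hyP hyQ => Subtype.ext (h hyP hyQ)
  obtain ⟨⟨a, b⟩, hab⟩ := hcompl.surjective ⟨x, hx⟩
  exact ⟨a, a.2, b, b.2, congrArg Subtype.val hab⟩

/-- A finite cyclic group has at most one subgroup of each order. -/
theorem subgroup_eq_of_card_eq_of_isCyclic {G : Type*} [Group G] [Finite G] [IsCyclic G]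
    {A B : Subgroup G} (h : Nat.card A = Nat.card B) : A = B := by
  classical
  have := Fintype.ofFinite G
  have key : ∀ D : Subgroup G, (D : Set G) = {x | x ^ Nat.card D = 1} := by
    intro D
    refine Set.eq_of_subset_of_ncard_le (fun x hx => ?_) ?_
    · exact congrArg Subtype.val (pow_card_eq_one' (x := (⟨x, hx⟩ : D)))
    · have hle := IsCyclic.card_pow_eq_one_le (α := G) (n := Nat.card D) Nat.card_pos
      rw [← Nat.card_coe_set_eq (D : Set G)]
      simpa [Set.ncard_eq_toFinset_card'] using hle
  exact SetLike.coe_injective (by rw [key A, key B, h])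

/-- A finite cyclic subgroup contains at most one subgroup of each order. -/
theorem eq_of_le_of_card_eq_of_isCyclic {G : Type*} [Group G] {C A B : Subgroup G} [IsCyclic C]
    [Finite C] (hA : A ≤ C) (hB : B ≤ C) (h : Nat.card A = Nat.card B) : A = B := by
  have hsub : A.subgroupOf C = B.subgroupOf C := by
    apply subgroup_eq_of_card_eq_of_isCyclic
    rw [Nat.card_congr (Subgroup.subgroupOfEquivOfLe hA).toEquiv,
      Nat.card_congr (Subgroup.subgroupOfEquivOfLe hB).toEquiv, h]
  rwa [Subgroup.subgroupOf_inj, inf_eq_left.2 hA, inf_eq_left.2 hB] at hsub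

theorem stmt5 {G : Type*} [Group G] [Finite G] (p : ℕ) (hp : p.Prime)
    (hG : IsPGroup p G) (𝒞 : Set (Subgroup G)) (h𝒞 : IsStarCover p 𝒞)
    (A B : Subgroup G) (hAB : A ≠ B)
    (hcardA : Nat.card A = p) (hcardB : Nat.card B = p)
    (C : Subgroup G) (hC : C ∈ 𝒞) (hA : A ≤ C) (hB : B ≤ C)
    (C₁ : Subgroup G) (hC₁ : C₁ ∈ 𝒞) (C₂ : Subgroup G) (hC₂ : C₂ ∈ 𝒞)
    (C₃ : Subgroup G) (hC₃ : C₃ ∈ 𝒞)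
    (hi1 : Nat.card ↥(C ⊓ C₁) = p) (hi2 : Nat.card ↥(C ⊓ C₂) = p)
    (hi3 : Nat.card ↥(C ⊓ C₃) = p)
    (hd12 : C ⊓ C₁ ≠ C ⊓ C₂) (hd13 : C ⊓ C₁ ≠ C ⊓ C₃) (hd23 : C ⊓ C₂ ≠ C ⊓ C₃) :
    ∀ f : G → G, InRC 𝒞 f → ∃ lam : ℕ, lam < p ∧ ∀ x ∈ C, f x = x ^ lam := by
  intro f hf
  have helem : IsElemAbelianP2 p C := (h𝒞.2 C hC).resolve_left fun hmax =>
    have := hmax.1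
    hAB (eq_of_le_of_card_eq_of_isCyclic hA hB (hcardA.trans hcardB.symm))
  obtain ⟨hcardC, hexp, hcomm⟩ := helem
  have hpow : ∀ D ∈ 𝒞, Nat.card ↥(C ⊓ D) = p → ∃ k : ℤ, ∀ x ∈ C ⊓ D, f x = x ^ k :=
    fun D hD hcard => exists_zpow_of_prime_card hp hcard
      (fun x hx => ⟨(hf C hC).1 x hx.1, (hf D hD).1 x hx.2⟩)
      fun u hu v hv => (hf C hC).2 u hu.1 v hv.1
  obtain ⟨k, hk⟩ := hpow C₁ hC₁ hi1
  obtain ⟨l, hl⟩ := hpow C₂ hC₂ hi2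
  obtain ⟨m, hm⟩ := hpow C₃ hC₃ hi3
  have hdecomp : ∀ {x}, x ∈ C → ∃ a ∈ C ⊓ C₁, ∃ b ∈ C ⊓ C₂, a * b = x :=
    exists_mul_eq_of_card_sq hp hi1 hi2 hcardC inf_le_left inf_le_left hd12
  have hmulzpow : ∀ a ∈ C, ∀ b ∈ C, (a * b) ^ m = a ^ m * b ^ m := fun a ha b hb =>
    Commute.mul_zpow (hcomm a ha b hb) m
  obtain ⟨c, hc, hc1⟩ : ∃ c ∈ C ⊓ C₃, c ≠ 1 := by
    refine (Subgroup.bot_or_exists_ne_one _).resolve_left fun h => ?_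
    rw [h, Subgroup.card_bot] at hi3
    exact hp.one_lt.ne hi3
  obtain ⟨a, ha, b, hb, rfl⟩ := hdecomp hc.1
  have ha1 : a ≠ 1 := by
    rintro rfl
    rw [one_mul] at hc hc1
    exact hc1 (Subgroup.disjoint_def.1 (disjoint_of_prime_card hp hi2 hi3 hd23) hb hc)
  have hb1 : b ≠ 1 := by
    rintro rfl
    rw [mul_one] at hc hc1
    exact hc1 (Subgroup.disjoint_def.1 (disjoint_of_prime_card hp hi1 hi3 hd13) ha hc)
  have hprod : a ^ k * b ^ l = a ^ m * b ^ m := by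
    rw [← hmulzpow a ha.1 b hb.1, ← hm _ hc, (hf C hC).2 a ha.1 b hb.1, hk a ha, hl b hb]
  obtain ⟨hkm, hlm⟩ : a ^ k = a ^ m ∧ b ^ l = b ^ m := by
    have h := Subgroup.mul_injective_of_disjoint (disjoint_of_prime_card hp hi1 hi2 hd12)
      (a₁ := (⟨_, zpow_mem ha k⟩, ⟨_, zpow_mem hb l⟩))
      (a₂ := (⟨_, zpow_mem ha m⟩, ⟨_, zpow_mem hb m⟩)) hprod
    simpa using h
  have hfm : ∀ x ∈ C, f x = x ^ m := by
    intro x hx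
    obtain ⟨u, hu, v, hv, rfl⟩ := hdecomp hx
    rw [(hf C hC).2 u hu.1 v hv.1, hk u hu, hl v hv, hmulzpow u hu.1 v hv.1,
      zpow_eq_zpow_of_prime_card hp hi1 ha ha1 hu hkm,
      zpow_eq_zpow_of_prime_card hp hi2 hb hb1 hv hlm]
  have hp0 : (0 : ℤ) < p := mod_cast hp.pos
  have hmod := Int.toNat_of_nonneg (Int.emod_nonneg m hp0.ne')
  refine ⟨(m % p).toNat, by have := Int.emod_lt_of_pos m hp0; omega, fun x hx => ?_⟩
  rw [hfm x hx, ← zpow_natCast, hmod]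
  conv_lhs => rw [← Int.mul_ediv_add_emod m p, zpow_add, zpow_mul, zpow_natCast, hexp x hx,
    one_zpow, one_mul]
end

section
/- Let p be a prime, G a finite p-group, 𝒞 a *-covering of G, and 𝒢 the 3-intersecting graph of G relative to 𝒞. Suppose A is a subgroup of G of order p whose connected component in 𝒢 contains more than one vertex. Then for every f ∈ R_𝒞(G) there exists a natural number λ with 0 ≤ λ < p such that for every subgroup K of order p lying in the connected component of A (i.e., K is reachable from A in 𝒢, or K = A) and every x ∈ K, one has f(x) = x^λ. -/
/-- Adjacency in the 3-intersecting graph of `G` relative to the cover `𝒞`: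
the vertices are the subgroups of order `p`, and two distinct vertices `A`, `B` are
adjacent iff some cell `C ∈ 𝒞` contains both, and there are cells `C₁, C₂, C₃ ∈ 𝒞`
such that `C ⊓ C₁`, `C ⊓ C₂`, `C ⊓ C₃` are three pairwise distinct subgroups of
order `p`. -/
def ThreeAdj {G : Type*} [Group G] (p : ℕ) (𝒞 : Set (Subgroup G))
    (A B : Subgroup G) : Prop :=
  A ≠ B ∧ Nat.card A = p ∧ Nat.card B = p ∧
    ∃ C ∈ 𝒞, A ≤ C ∧ B ≤ C ∧
      ∃ C₁ ∈ 𝒞, ∃ C₂ ∈ 𝒞, ∃ C₃ ∈ 𝒞,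
        Nat.card ↥(C ⊓ C₁) = p ∧ Nat.card ↥(C ⊓ C₂) = p ∧ Nat.card ↥(C ⊓ C₃) = p ∧
        C ⊓ C₁ ≠ C ⊓ C₂ ∧ C ⊓ C₁ ≠ C ⊓ C₃ ∧ C ⊓ C₂ ≠ C ⊓ C₃

namespace Subgroup

variable {G : Type*} [Group G]

/-- Two distinct subgroups of the same prime order intersect trivially. -/
theorem inf_eq_bot_of_prime_card_of_ne [Finite G] {p : ℕ} (hp : p.Prime) {D E : Subgroup G}
    (hD : Nat.card D = p) (hE : Nat.card E = p) (hne : D ≠ E) : D ⊓ E = ⊥ := by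
  have hdvd : Nat.card ↥(D ⊓ E) ∣ p := hD ▸ card_dvd_of_le inf_le_left
  rcases (Nat.dvd_prime hp).mp hdvd with h | h
  · exact card_eq_one.mp h
  · exact absurd ((eq_of_le_of_card_ge inf_le_left (hD.trans h.symm).le).symm.trans
      (eq_of_le_of_card_ge inf_le_right (hE.trans h.symm).le)) hne

/-- A nontrivial element of a subgroup of prime order generates it. -/
theorem exists_pow_eq_of_prime_card {p : ℕ} (hp : p.Prime) {D : Subgroup G}
    (hD : Nat.card D = p) {x y : G} (hx : x ∈ D) (hy : y ∈ D) (hx1 : x ≠ 1) :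
    ∃ n : ℕ, x ^ n = y := by
  have : Fact p.Prime := ⟨hp⟩
  obtain ⟨n, hn⟩ := mem_powers_of_prime_card hD (g := ⟨x, hx⟩) (g' := ⟨y, hy⟩)
    (fun h => hx1 (congrArg Subtype.val h))
  exact ⟨n, congrArg Subtype.val hn⟩

/-- A finite cyclic subgroup contains at most one subgroup of each order. -/
theorem eq_of_le_of_le_of_isCyclic_of_card_eq [Finite G] {C D E : Subgroup G} (hC : IsCyclic C)
    (hD : D ≤ C) (hE : E ≤ C) (h : Nat.card D = Nat.card E) : D = E := by
  classical
  let _ := Fintype.ofFinite C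
  have key : ∀ F : Subgroup G, F ≤ C → Nat.card F = Nat.card E →
      ((F.subgroupOf C : Subgroup C) : Set C) = {a : C | a ^ Nat.card E = 1} := by
    intro F hF hcard
    refine Set.eq_of_subset_of_ncard_le (fun a ha => ?_) ?_
    · have hF1 : (⟨a, mem_subgroupOf.mp ha⟩ : F) ^ Nat.card F = 1 := pow_card_eq_one'
      have hE1 : (a : G) ^ Nat.card E = 1 := hcard ▸ congrArg Subtype.val hF1
      exact Subtype.ext hE1
    · have h1 := IsCyclic.card_pow_eq_one_le (α := C) (n := Nat.card E) Nat.card_pos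
      have h2 : ((F.subgroupOf C : Subgroup C) : Set C).ncard = Nat.card E := by
        rw [← hcard, ← Nat.card_congr (subgroupOfEquivOfLe hF).toEquiv]
        rfl
      rw [h2, Set.ncard_eq_toFinset_card']
      simpa using h1
  have h3 : D.subgroupOf C = E.subgroupOf C :=
    SetLike.coe_injective ((key D hD h).trans (key E hE rfl).symm)
  rwa [subgroupOf_inj, inf_eq_left.mpr hD, inf_eq_left.mpr hE] at h3

/-- In a group of order `p ^ 2`, any two distinct subgroups of order `p` generate
the whole group as a product set. -/
theorem exists_mul_eq_of_card_eq_sq [Finite G] {p : ℕ} (hp : p.Prime) {C D E : Subgroup G}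
    (hC : Nat.card C = p ^ 2) (hDC : D ≤ C) (hEC : E ≤ C) (hD : Nat.card D = p)
    (hE : Nat.card E = p) (hne : D ≠ E) {c : G} (hc : c ∈ C) :
    ∃ u ∈ D, ∃ v ∈ E, u * v = c := by
  have hdisj : Disjoint D E := disjoint_iff.mpr (inf_eq_bot_of_prime_card_of_ne hp hD hE hne)
  let m : D × E → C := fun q => ⟨q.1 * q.2, C.mul_mem (hDC q.1.2) (hEC q.2.2)⟩
  have hinj : Function.Injective m := fun q r h =>
    mul_injective_of_disjoint hdisj (congrArg Subtype.val h)
  have hcard : Nat.card C ≤ Nat.card (D × E) := by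
    rw [Nat.card_prod, hC, hD, hE, sq]
  obtain ⟨⟨u, v⟩, huv⟩ := (hinj.bijective_of_nat_card_le hcard).2 ⟨c, hc⟩
  exact ⟨u, u.2, v, v.2, congrArg Subtype.val huv⟩

end Subgroup

section

variable {G : Type*} [Group G]

theorem InRC.map_pow {𝒞 : Set (Subgroup G)} {f : G → G} (hf : InRC 𝒞 f) {C : Subgroup G}
    (hC : C ∈ 𝒞) {x : G} (hx : x ∈ C) (n : ℕ) : f (x ^ n) = f x ^ n := by
  induction n with
  | zero =>
    have h := (hf C hC).2 1 C.one_mem 1 C.one_mem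
    simpa using h
  | succ k ih => rw [pow_succ, pow_succ, (hf C hC).2 _ (C.pow_mem hx k) _ hx, ih]

/-- An endomorphism of an elementary abelian group of order `p ^ 2` that preserves three distinct
subgroups of order `p` is a power map. -/
theorem InRC.exists_eq_pow_of_three [Finite G] {p : ℕ} (hp : p.Prime) {𝒞 : Set (Subgroup G)}
    {f : G → G} (hf : InRC 𝒞 f) {C D₁ D₂ D₃ : Subgroup G} (hC : C ∈ 𝒞)
    (hel : IsElemAbelianP2 p C) (hle₁ : D₁ ≤ C) (hle₂ : D₂ ≤ C) (hle₃ : D₃ ≤ C)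
    (h₁ : Nat.card D₁ = p) (h₂ : Nat.card D₂ = p) (h₃ : Nat.card D₃ = p)
    (h₁₂ : D₁ ≠ D₂) (h₁₃ : D₁ ≠ D₃) (h₂₃ : D₂ ≠ D₃)
    (hf₁ : ∀ x ∈ D₁, f x ∈ D₁) (hf₂ : ∀ x ∈ D₂, f x ∈ D₂) (hf₃ : ∀ x ∈ D₃, f x ∈ D₃) :
    ∃ lam < p, ∀ x ∈ C, f x = x ^ lam := by
  obtain ⟨hcard, hexp, hcomm⟩ := hel
  obtain ⟨c, hc, hc1⟩ := D₃.bot_or_exists_ne_one.resolve_left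
    fun h => hp.one_lt.ne' (by rw [← h₃, h, Subgroup.card_bot])
  obtain ⟨u, hu, v, hv, rfl⟩ :=
    Subgroup.exists_mul_eq_of_card_eq_sq hp hcard hle₁ hle₂ h₁ h₂ h₁₂ (hle₃ hc)
  have hu1 : u ≠ 1 := by
    rintro rfl
    rw [one_mul] at hc hc1
    have : v ∈ D₂ ⊓ D₃ := ⟨hv, hc⟩
    rw [Subgroup.inf_eq_bot_of_prime_card_of_ne hp h₂ h₃ h₂₃] at this
    exact hc1 (Subgroup.mem_bot.mp this)
  have hv1 : v ≠ 1 := by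
    rintro rfl
    rw [mul_one] at hc hc1
    have : u ∈ D₁ ⊓ D₃ := ⟨hu, hc⟩
    rw [Subgroup.inf_eq_bot_of_prime_card_of_ne hp h₁ h₃ h₁₃] at this
    exact hc1 (Subgroup.mem_bot.mp this)
  obtain ⟨n, hn⟩ := Subgroup.exists_pow_eq_of_prime_card hp h₃ hc (hf₃ _ hc) hc1
  have hcom : ∀ {x y : G}, x ∈ C → y ∈ C → Commute x y := fun hx hy => hcomm _ hx _ hy
  rw [(hf C hC).2 u (hle₁ hu) v (hle₂ hv), (hcom (hle₁ hu) (hle₂ hv)).mul_pow] at hn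
  have hpair := Subgroup.mul_injective_of_disjoint
    (disjoint_iff.mpr (Subgroup.inf_eq_bot_of_prime_card_of_ne hp h₁ h₂ h₁₂))
    (a₁ := (⟨u ^ n, D₁.pow_mem hu n⟩, ⟨v ^ n, D₂.pow_mem hv n⟩))
    (a₂ := (⟨f u, hf₁ u hu⟩, ⟨f v, hf₂ v hv⟩)) hn
  have hfu : u ^ n = f u := congrArg (fun q => (q.1 : G)) hpair
  have hfv : v ^ n = f v := congrArg (fun q => (q.2 : G)) hpair
  refine ⟨n % p, Nat.mod_lt _ hp.pos, fun x hx => ?_⟩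
  rw [← pow_eq_pow_mod n (hexp x hx)]
  obtain ⟨y, hy, z, hz, rfl⟩ :=
    Subgroup.exists_mul_eq_of_card_eq_sq hp hcard hle₁ hle₂ h₁ h₂ h₁₂ hx
  obtain ⟨i, rfl⟩ := Subgroup.exists_pow_eq_of_prime_card hp h₁ hu hy hu1
  obtain ⟨j, rfl⟩ := Subgroup.exists_pow_eq_of_prime_card hp h₂ hv hz hv1
  rw [(hf C hC).2 _ (hle₁ hy) _ (hle₂ hz), (hcom (hle₁ hy) (hle₂ hz)).mul_pow,
    hf.map_pow hC (hle₁ hu), hf.map_pow hC (hle₂ hv), ← hfu, ← hfv,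
    ← pow_mul, ← pow_mul, ← pow_mul, ← pow_mul, mul_comm i, mul_comm j]

theorem ThreeAdj.exists_eq_pow [Finite G] {p : ℕ} (hp : p.Prime) {𝒞 : Set (Subgroup G)}
    (h𝒞 : IsStarCover p 𝒞) {f : G → G} (hf : InRC 𝒞 f) {A B : Subgroup G}
    (h : ThreeAdj p 𝒞 A B) :
    ∃ lam < p, (∀ x ∈ A, f x = x ^ lam) ∧ ∀ x ∈ B, f x = x ^ lam := by
  obtain ⟨hne, hA, hB, C, hC, hAC, hBC, C₁, hC₁, C₂, hC₂, C₃, hC₃, h₁, h₂, h₃, h₁₂, h₁₃, h₂₃⟩ := h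
  have hinv : ∀ E ∈ 𝒞, ∀ x ∈ C ⊓ E, f x ∈ C ⊓ E := fun E hE x hx =>
    ⟨(hf C hC).1 x hx.1, (hf E hE).1 x hx.2⟩
  rcases h𝒞.2 C hC with hcyc | hel
  · exact absurd (Subgroup.eq_of_le_of_le_of_isCyclic_of_card_eq hcyc.1 hAC hBC
      (hA.trans hB.symm)) hne
  · obtain ⟨lam, hlam, hpow⟩ := hf.exists_eq_pow_of_three hp hC hel inf_le_left inf_le_left
      inf_le_left h₁ h₂ h₃ h₁₂ h₁₃ h₂₃ (hinv C₁ hC₁) (hinv C₂ hC₂) (hinv C₃ hC₃)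
    exact ⟨lam, hlam, fun x hx => hpow x (hAC hx), fun x hx => hpow x (hBC hx)⟩

/-- The exponent of a power map on a subgroup of prime order `p` is determined modulo `p`. -/
theorem Subgroup.eq_of_forall_pow_eq_pow {p : ℕ} (hp : p.Prime) {K : Subgroup G}
    (hK : Nat.card K = p) {m n : ℕ} (hm : m < p) (hn : n < p)
    (h : ∀ x ∈ K, x ^ m = x ^ n) : m = n := by
  obtain ⟨a, ha⟩ := K.ne_bot_iff_exists_ne_one.mp
    (fun h => hp.one_lt.ne' (by rw [← hK, h, Subgroup.card_bot]))
  have : Fact p.Prime := ⟨hp⟩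
  have hord : orderOf (a : G) = p := orderOf_eq_prime
    (hK ▸ congrArg Subtype.val (pow_card_eq_one' (x := a))) (fun h => ha (Subtype.ext h))
  exact pow_injOn_Iio_orderOf (by simpa [hord] using hm) (by simpa [hord] using hn) (h a a.2)

end

theorem stmt6 {G : Type*} [Group G] [Finite G] (p : ℕ) (hp : p.Prime)
    (hG : IsPGroup p G) (𝒞 : Set (Subgroup G)) (h𝒞 : IsStarCover p 𝒞)
    (A : Subgroup G) (hcardA : Nat.card A = p)
    (hbig : ∃ B : Subgroup G, B ≠ A ∧ Relation.ReflTransGen (ThreeAdj p 𝒞) A B) :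
    ∀ f : G → G, InRC 𝒞 f → ∃ lam : ℕ, lam < p ∧
      ∀ K : Subgroup G, Nat.card K = p → Relation.ReflTransGen (ThreeAdj p 𝒞) A K →
        ∀ x ∈ K, f x = x ^ lam := by
  intro f hf
  obtain ⟨B, hBA, hAB⟩ := hbig
  obtain rfl | ⟨B', hAB', -⟩ := hAB.cases_head
  · exact absurd rfl hBA
  obtain ⟨lam, hlam, hlamA, -⟩ := hAB'.exists_eq_pow hp h𝒞 hf
  refine ⟨lam, hlam, fun K _ hAK => ?_⟩
  induction hAK with
  | refl => exact hlamA
  | tail _ hadj ih =>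
    obtain ⟨mu, hmu, hmu₁, hmu₂⟩ := hadj.exists_eq_pow hp h𝒞 hf
    have hcard := hadj.2.1
    have heq : lam = mu := Subgroup.eq_of_forall_pow_eq_pow hp hcard hlam hmu
      fun x hx => (ih hcard x hx).symm.trans (hmu₁ x hx)
    exact heq ▸ hmu₂
end

section
/- Let Q₈ be the quaternion group of order 8 with generators x, y satisfying x⁴ = 1, x² = y², y⁻¹xy = x⁻¹, and let 𝒞 = {⟨x⟩, ⟨y⟩, ⟨xy⟩}. Then the set R_𝒞(Q₈) of functions f : Q₈ → Q₈ whose restriction to each of ⟨x⟩, ⟨y⟩, ⟨xy⟩ maps that subgroup into itself and is multiplicative on it has exactly 16 elements; indeed the map sending f to the triple (a, b, c) ∈ (ℤ/4ℤ)³ determined by f(x) = x^a, f(y) = y^b, f(xy) = (xy)^c is a bijection from R_𝒞(Q₈) onto {(a, b, c) ∈ (ℤ/4ℤ)³ : 2a = 2b = 2c}. -/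
section PowerFunctions

variable {G : Type*} [Group G]

/-- If `g ∉ H` but `g ^ 2 ∈ H` and `g ^ 4 = 1`, then `⟨g⟩ ∩ H` has exponent two. -/
lemma sq_eq_one_of_mem_zpowers_of_mem {H : Subgroup G} {g u : G} (hg : g ∉ H)
    (hg2 : g ^ 2 ∈ H) (hg4 : g ^ 4 = 1) (hu : u ∈ Subgroup.zpowers g) (huH : u ∈ H) :
    u ^ 2 = 1 := by
  obtain ⟨k, rfl⟩ := Subgroup.mem_zpowers_iff.1 hu
  have hpow (m : ℤ) : g ^ (2 * m) ∈ H := by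
    rw [zpow_mul]
    exact H.zpow_mem (by exact_mod_cast hg2) m
  obtain ⟨m, rfl⟩ | ⟨m, rfl⟩ := k.even_or_odd
  · have h : (g ^ (m + m)) ^ 2 = (g ^ 4) ^ m := by
      rw [← zpow_natCast, ← zpow_natCast, ← zpow_mul, ← zpow_mul]
      congr 1
      push_cast
      ring
    rw [h, hg4, one_zpow]
  · rw [zpow_add, zpow_one] at huH
    exact absurd ((H.mul_mem_cancel_left (hpow m)).1 huH) hg

lemma pow_eq_pow_of_sq_eq_one {u : G} (hu : u ^ 2 = 1) {a b : ZMod 4}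
    (hab : 2 * a = 2 * b) : u ^ a.val = u ^ b.val := by
  have key : ∀ a b : ZMod 4, 2 * a = 2 * b → a.val ≡ b.val [MOD 2] := by decide
  exact pow_eq_pow_iff_modEq.2 ((key a b hab).of_dvd (orderOf_dvd_of_pow_eq_one hu))

lemma pow_val_injective {g : G} (hg : orderOf g = 4) {a b : ZMod 4}
    (h : g ^ a.val = g ^ b.val) : a = b := by
  rw [pow_eq_pow_iff_modEq, hg] at h
  simpa using (ZMod.natCast_eq_natCast_iff _ _ _).2 h

/-- A function which agrees on every cell with some power map of that cell lies in `R_𝒞(G)`,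
provided the cells are cyclic. -/
lemma inRC_of_forall_pow {𝒞 : Set (Subgroup G)} {f : G → G}
    (h : ∀ C ∈ 𝒞, ∃ g : G, C = Subgroup.zpowers g ∧ ∃ n : ℕ, ∀ u ∈ C, f u = u ^ n) :
    InRC 𝒞 f := by
  intro C hC
  obtain ⟨g, rfl, n, hn⟩ := h C hC
  refine ⟨fun u hu => hn u hu ▸ pow_mem hu n, fun u hu v hv => ?_⟩
  rw [hn u hu, hn v hv, hn _ (mul_mem hu hv)]
  obtain ⟨k, rfl⟩ := Subgroup.mem_zpowers_iff.1 hu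
  obtain ⟨m, rfl⟩ := Subgroup.mem_zpowers_iff.1 hv
  exact ((Commute.refl g).zpow_zpow k m).mul_pow n

/-- On a cell that is cyclic of order four, a member of `R_𝒞(G)` is a power map. -/
lemma InRC.exists_pow {𝒞 : Set (Subgroup G)} {f : G → G} (hf : InRC 𝒞 f) {g : G}
    (hg : orderOf g = 4) (hC : Subgroup.zpowers g ∈ 𝒞) :
    ∃ a : ZMod 4, ∀ u ∈ Subgroup.zpowers g, f u = u ^ a.val := by
  obtain ⟨hmem, hmul⟩ := hf _ hC
  have hfin : IsOfFinOrder g := orderOf_pos_iff.1 (by omega)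
  have hone : f 1 = 1 := by simpa using hmul 1 (one_mem _) 1 (one_mem _)
  have hpow (n : ℕ) : f (g ^ n) = f g ^ n := by
    induction n with
    | zero => simpa using hone
    | succ n ih =>
      rw [pow_succ, pow_succ, ← ih]
      exact hmul _ (Subgroup.npow_mem_zpowers g n) _ (Subgroup.mem_zpowers g)
  obtain ⟨k, hk⟩ := hfin.mem_powers_iff_mem_zpowers.2 (hmem g (Subgroup.mem_zpowers g))
  have hk' : g ^ (k : ZMod 4).val = f g := by
    rw [ZMod.val_natCast, ← hg, pow_mod_orderOf]
    exact hk
  refine ⟨k, fun u hu => ?_⟩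
  obtain ⟨n, rfl⟩ := hfin.mem_powers_iff_mem_zpowers.2 hu
  change f (g ^ n) = (g ^ n) ^ _
  rw [hpow, ← hk', pow_right_comm]

/-- If `G` is the union of three cyclic groups `⟨x⟩`, `⟨y⟩`, `⟨w⟩` of order four, none of them
contained in a previous one, and `x ^ 2 = y ^ 2 = w ^ 2`, then `R_𝒞(G)` is parametrized by the
triples `(a, b, c)` of elements of `ℤ/4ℤ` with `2a = 2b = 2c`. -/
lemma exists_equiv_of_three_cyclic {x y w : G} (hx : orderOf x = 4) (hy : orderOf y = 4)
    (hw : orderOf w = 4) (hxy : x ^ 2 = y ^ 2) (hyw : y ^ 2 = w ^ 2)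
    (hyx : y ∉ Subgroup.zpowers x) (hwx : w ∉ Subgroup.zpowers x)
    (hwy : w ∉ Subgroup.zpowers y)
    (hcover : ∀ g : G, g ∈ Subgroup.zpowers x ∨ g ∈ Subgroup.zpowers y ∨
      g ∈ Subgroup.zpowers w) :
    ∃ e : {f : G → G //
        InRC ({Subgroup.zpowers x, Subgroup.zpowers y, Subgroup.zpowers w} :
          Set (Subgroup G)) f} ≃
        {t : ZMod 4 × ZMod 4 × ZMod 4 // 2 * t.1 = 2 * t.2.1 ∧ 2 * t.2.1 = 2 * t.2.2},
      ∀ f, f.1 x = x ^ ((e f).1.1.val) ∧ f.1 y = y ^ ((e f).1.2.1.val) ∧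
        f.1 w = w ^ ((e f).1.2.2.val) := by
  classical
  let F (t : ZMod 4 × ZMod 4 × ZMod 4) (g : G) : G :=
    if g ∈ Subgroup.zpowers x then g ^ t.1.val
    else if g ∈ Subgroup.zpowers y then g ^ t.2.1.val else g ^ t.2.2.val
  have hF1 (t) : ∀ u ∈ Subgroup.zpowers x, F t u = u ^ t.1.val := fun u hu => if_pos hu
  have hy4 : y ^ 4 = 1 := hy ▸ pow_orderOf_eq_one y
  have hw4 : w ^ 4 = 1 := hw ▸ pow_orderOf_eq_one w
  have hF2 (t : ZMod 4 × ZMod 4 × ZMod 4) (h : 2 * t.1 = 2 * t.2.1) :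
      ∀ u ∈ Subgroup.zpowers y, F t u = u ^ t.2.1.val := by
    intro u hu
    by_cases hux : u ∈ Subgroup.zpowers x
    · rw [hF1 t u hux]
      exact pow_eq_pow_of_sq_eq_one (sq_eq_one_of_mem_zpowers_of_mem hyx
        (hxy ▸ Subgroup.npow_mem_zpowers x 2) hy4 hu hux) h
    · exact (if_neg hux).trans (if_pos hu)
  have hF3 (t : ZMod 4 × ZMod 4 × ZMod 4) (h : 2 * t.1 = 2 * t.2.1 ∧ 2 * t.2.1 = 2 * t.2.2) :
      ∀ u ∈ Subgroup.zpowers w, F t u = u ^ t.2.2.val := by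
    intro u hu
    by_cases hux : u ∈ Subgroup.zpowers x
    · rw [hF1 t u hux]
      exact pow_eq_pow_of_sq_eq_one (sq_eq_one_of_mem_zpowers_of_mem hwx
        (hxy.trans hyw ▸ Subgroup.npow_mem_zpowers x 2) hw4 hu hux) (h.1.trans h.2)
    · by_cases huy : u ∈ Subgroup.zpowers y
      · rw [hF2 t h.1 u huy]
        exact pow_eq_pow_of_sq_eq_one (sq_eq_one_of_mem_zpowers_of_mem hwy
          (hyw ▸ Subgroup.npow_mem_zpowers y 2) hw4 hu huy) h.2
      · exact (if_neg hux).trans (if_neg huy)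
  let E : {t : ZMod 4 × ZMod 4 × ZMod 4 // 2 * t.1 = 2 * t.2.1 ∧ 2 * t.2.1 = 2 * t.2.2} →
      {f : G → G // InRC ({Subgroup.zpowers x, Subgroup.zpowers y, Subgroup.zpowers w} :
        Set (Subgroup G)) f} := fun t => ⟨F t.1, inRC_of_forall_pow (by
    rintro C (rfl | rfl | rfl)
    · exact ⟨x, rfl, _, hF1 t.1⟩
    · exact ⟨y, rfl, _, hF2 t.1 t.2.1⟩
    · exact ⟨w, rfl, _, hF3 t.1 t.2⟩)⟩
  have hE (t) : (E t).1 x = x ^ t.1.1.val ∧ (E t).1 y = y ^ t.1.2.1.val ∧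
      (E t).1 w = w ^ t.1.2.2.val :=
    ⟨hF1 t.1 x (Subgroup.mem_zpowers x), hF2 t.1 t.2.1 y (Subgroup.mem_zpowers y),
      hF3 t.1 t.2 w (Subgroup.mem_zpowers w)⟩
  have hinj : Function.Injective E := by
    intro s t hst
    obtain ⟨hs1, hs2, hs3⟩ := hE s
    obtain ⟨ht1, ht2, ht3⟩ := hE t
    rw [hst] at hs1 hs2 hs3
    exact Subtype.ext (Prod.ext (pow_val_injective hx (hs1.symm.trans ht1))
      (Prod.ext (pow_val_injective hy (hs2.symm.trans ht2))
        (pow_val_injective hw (hs3.symm.trans ht3))))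
  have hsurj : Function.Surjective E := by
    rintro ⟨f, hf⟩
    obtain ⟨a, ha⟩ := hf.exists_pow hx (by simp)
    obtain ⟨b, hb⟩ := hf.exists_pow hy (by simp)
    obtain ⟨c, hc⟩ := hf.exists_pow hw (by simp)
    have hparity {a b : ZMod 4} (h : (x ^ 2) ^ a.val = (x ^ 2) ^ b.val) : 2 * a = 2 * b := by
      rw [← pow_mul, ← pow_mul, pow_eq_pow_iff_modEq, hx] at h
      simpa using (ZMod.natCast_eq_natCast_iff _ _ _).2 h
    have hfa := ha _ (Subgroup.npow_mem_zpowers x 2)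
    have hfb := hb _ (Subgroup.npow_mem_zpowers y 2)
    have hfc := hc _ (Subgroup.npow_mem_zpowers w 2)
    rw [← hyw, ← hxy] at hfc
    rw [← hxy] at hfb
    have hab := hparity (hfa.symm.trans hfb)
    have hbc := hparity (hfb.symm.trans hfc)
    refine ⟨⟨(a, b, c), hab, hbc⟩, Subtype.ext (funext fun g => ?_)⟩
    obtain hg | hg | hg := hcover g
    · exact (hF1 _ g hg).trans (ha g hg).symm
    · exact (hF2 _ hab g hg).trans (hb g hg).symm
    · exact (hF3 _ ⟨hab, hbc⟩ g hg).trans (hc g hg).symm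
  let e := Equiv.ofBijective E ⟨hinj, hsurj⟩
  refine ⟨e.symm, fun f => ?_⟩
  have h := hE (e.symm f)
  rwa [show E (e.symm f) = f from e.apply_symm_apply f] at h

end PowerFunctions

section QuaternionRelations

variable {G : Type*} [Group G] {x y : G}

lemma mul_zpow_of_conj_eq_inv (hconj : y⁻¹ * x * y = x⁻¹) (i : ℤ) :
    y * x ^ i = x ^ (-i) * y := by
  have h : SemiconjBy y x⁻¹ x := by
    rw [SemiconjBy, ← hconj]
    group
  have h' := h.zpow_right (-i)
  rwa [inv_zpow', neg_neg] at h'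

/-- Every element of a group generated by `x`, `y` with `x ^ 2 = y ^ 2` and `y⁻¹xy = x⁻¹` has the
form `x ^ i` or `x ^ i * y`. -/
lemma exists_eq_zpow_or_eq_zpow_mul (hxy : x ^ 2 = y ^ 2) (hconj : y⁻¹ * x * y = x⁻¹)
    (hgen : Subgroup.closure {x, y} = (⊤ : Subgroup G)) (g : G) :
    ∃ i : ℤ, g = x ^ i ∨ g = x ^ i * y := by
  have hy2 : y * y = x ^ (2 : ℤ) := by
    rw [← pow_two, ← hxy]
    norm_cast
  have hyinv : y⁻¹ = x ^ (-2 : ℤ) * y := by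
    rw [zpow_neg, ← hy2]
    group
  have hmulx (j : ℤ) (h : G) (hh : ∃ i : ℤ, h = x ^ i ∨ h = x ^ i * y) :
      ∃ i : ℤ, x ^ j * h = x ^ i ∨ x ^ j * h = x ^ i * y := by
    obtain ⟨i, rfl | rfl⟩ := hh
    · exact ⟨j + i, .inl (zpow_add x j i).symm⟩
    · exact ⟨j + i, .inr (by rw [zpow_add, mul_assoc])⟩
  have hmuly (h : G) (hh : ∃ i : ℤ, h = x ^ i ∨ h = x ^ i * y) :
      ∃ i : ℤ, y * h = x ^ i ∨ y * h = x ^ i * y := by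
    obtain ⟨i, rfl | rfl⟩ := hh
    · exact ⟨-i, .inr (mul_zpow_of_conj_eq_inv hconj i)⟩
    · exact ⟨-i + 2, .inl (by
        rw [← mul_assoc, mul_zpow_of_conj_eq_inv hconj, mul_assoc, hy2, zpow_add])⟩
  have hg : g ∈ Subgroup.closure {x, y} := hgen ▸ Subgroup.mem_top g
  induction hg using Subgroup.closure_induction_left with
  | one => exact ⟨0, .inl (zpow_zero x).symm⟩
  | mul_left a ha h _ ih =>
    obtain rfl | rfl := ha
    · simpa using hmulx 1 h ih
    · exact hmuly h ih
  | inv_mul_cancel a ha h _ ih =>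
    obtain rfl | rfl := ha
    · simpa using hmulx (-1) h ih
    · rw [hyinv, mul_assoc]
      exact hmulx (-2) _ (hmuly h ih)

lemma mul_sq_of_conj_eq_inv (hconj : y⁻¹ * x * y = x⁻¹) : (x * y) ^ 2 = y ^ 2 := by
  have h := mul_zpow_of_conj_eq_inv hconj 1
  rw [zpow_one, zpow_neg_one] at h
  rw [pow_two, mul_assoc, ← mul_assoc y, h, pow_two]
  group

lemma mem_zpowers_or_mem_zpowers_or_mem_zpowers (hxy : x ^ 2 = y ^ 2)
    (hconj : y⁻¹ * x * y = x⁻¹) (hgen : Subgroup.closure {x, y} = (⊤ : Subgroup G)) (g : G) :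
    g ∈ Subgroup.zpowers x ∨ g ∈ Subgroup.zpowers y ∨ g ∈ Subgroup.zpowers (x * y) := by
  obtain ⟨i, rfl | rfl⟩ := exists_eq_zpow_or_eq_zpow_mul hxy hconj hgen g
  · exact .inl (Subgroup.zpow_mem_zpowers x i)
  have hmem {z : G} (hz : x ^ 2 = z ^ 2) (m : ℤ) : x ^ (2 * m) * z ∈ Subgroup.zpowers z := by
    rw [zpow_mul, zpow_ofNat, hz]
    exact mul_mem (zpow_mem (Subgroup.npow_mem_zpowers z 2) m) (Subgroup.mem_zpowers z)
  obtain ⟨m, rfl⟩ | ⟨m, rfl⟩ := i.even_or_odd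
  · rw [← two_mul]
    exact .inr (.inl (hmem hxy m))
  · rw [zpow_add, zpow_one, mul_assoc]
    exact .inr (.inr (hmem (hxy.trans (mul_sq_of_conj_eq_inv hconj).symm) m))

lemma card_le_two_mul_orderOf [Finite G] (hxy : x ^ 2 = y ^ 2)
    (hconj : y⁻¹ * x * y = x⁻¹) (hgen : Subgroup.closure {x, y} = (⊤ : Subgroup G)) :
    Nat.card G ≤ 2 * orderOf x := by
  let φ : Subgroup.zpowers x ⊕ Subgroup.zpowers x → G :=
    Sum.elim (fun u => u) (fun u => u * y)
  have hφ : Function.Surjective φ := by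
    intro g
    obtain ⟨i, rfl | rfl⟩ := exists_eq_zpow_or_eq_zpow_mul hxy hconj hgen g
    · exact ⟨.inl ⟨_, Subgroup.zpow_mem_zpowers x i⟩, rfl⟩
    · exact ⟨.inr ⟨_, Subgroup.zpow_mem_zpowers x i⟩, rfl⟩
  have h := Nat.card_le_card_of_surjective φ hφ
  rwa [Nat.card_sum, Nat.card_zpowers, ← two_mul] at h

end QuaternionRelations

/-- `G` is the quaternion group of order 8 with generators `x`, `y`, and
`𝒞 = {⟨x⟩, ⟨y⟩, ⟨xy⟩}`.  Then `R_𝒞(G)` has exactly 16 elements; indeed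
`f ↦ (a, b, c)`, where `f x = x ^ a`, `f y = y ^ b`, `f (xy) = (xy) ^ c`, is a
bijection onto `{(a, b, c) ∈ (ℤ/4ℤ)³ : 2a = 2b = 2c}`. -/
theorem stmt10 {G : Type*} [Group G] [Finite G] (hcard : Nat.card G = 8)
    (x y : G) (hx4 : x ^ 4 = 1) (hxy : x ^ 2 = y ^ 2) (hconj : y⁻¹ * x * y = x⁻¹)
    (hgen : Subgroup.closure {x, y} = (⊤ : Subgroup G)) :
    Nat.card {f : G → G //
        InRC ({Subgroup.zpowers x, Subgroup.zpowers y, Subgroup.zpowers (x * y)} :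
          Set (Subgroup G)) f} = 16 ∧
    ∃ e : {f : G → G //
        InRC ({Subgroup.zpowers x, Subgroup.zpowers y, Subgroup.zpowers (x * y)} :
          Set (Subgroup G)) f} ≃
        {t : ZMod 4 × ZMod 4 × ZMod 4 // 2 * t.1 = 2 * t.2.1 ∧ 2 * t.2.1 = 2 * t.2.2},
      ∀ f, f.1 x = x ^ ((e f).1.1.val) ∧ f.1 y = y ^ ((e f).1.2.1.val) ∧
        f.1 (x * y) = (x * y) ^ ((e f).1.2.2.val) := by
  have hsq := mul_sq_of_conj_eq_inv hconj
  have hx2 : x ^ 2 ≠ 1 := by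
    intro h
    have := card_le_two_mul_orderOf hxy hconj hgen
    have := orderOf_le_of_pow_eq_one two_pos h
    omega
  have horder {z : G} (hz : x ^ 2 = z ^ 2) : orderOf z = 4 := by
    refine orderOf_eq_prime_pow (p := 2) (n := 1) (by simpa [← hz] using hx2) ?_
    rw [show 2 ^ (1 + 1) = 2 * 2 from rfl, pow_mul, ← hz, ← pow_mul, hx4]
  have hnotMem {z : G} (hz : x ^ 2 = z ^ 2) (hxz : x ∈ Subgroup.zpowers z)
      (hyz : y ∈ Subgroup.zpowers z) : False := by
    have htop : Subgroup.zpowers z = ⊤ := by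
      rw [eq_top_iff, ← hgen, Subgroup.closure_le]
      rintro u (rfl | rfl)
      exacts [hxz, hyz]
    have h := Nat.card_zpowers z
    rw [htop, Subgroup.card_top, hcard, horder hz] at h
    omega
  have hx := Subgroup.mem_zpowers x
  have hy := Subgroup.mem_zpowers y
  obtain ⟨e, he⟩ := exists_equiv_of_three_cyclic (horder rfl) (horder hxy)
    (horder (hxy.trans hsq.symm)) hxy hsq.symm (hnotMem rfl hx)
    (fun h => hnotMem rfl hx ((Subgroup.mul_mem_cancel_left _ hx).1 h))
    (fun h => hnotMem hxy ((Subgroup.mul_mem_cancel_right _ hy).1 h) hy)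
    (mem_zpowers_or_mem_zpowers_or_mem_zpowers hxy hconj hgen)
  refine ⟨?_, e, he⟩
  rw [Nat.card_congr e, Nat.card_eq_fintype_card]
  decide
end

section
/- Let p be a prime and G a nontrivial finite p-group of exponent p (every element of G satisfies x^p = 1). Suppose |C_G(a)| ≥ p³ for every a ∈ G, where C_G(a) is the centralizer of a in G. Then there exists a *-covering 𝒞 of G such that the map from {0, 1, …, p−1} to R_𝒞(G) sending λ to the function x ↦ x^λ is a bijection onto R_𝒞(G); that is, every f ∈ R_𝒞(G) equals x ↦ x^λ for exactly one λ with 0 ≤ λ < p, and every such power map belongs to R_𝒞(G). -/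
/-- Two commuting elements of exponent `p`, the first nontrivial and the second not a power of
the first, lie in a common elementary abelian subgroup of order `p ^ 2`. -/
theorem exists_isElemAbelianP2 {G : Type*} [Group G] {p : ℕ} (hp : p.Prime)
    (hexp : ∀ g : G, g ^ p = 1) {a b : G} (ha : a ≠ 1) (hab : Commute a b)
    (hb : b ∉ Subgroup.zpowers a) : ∃ C : Subgroup G, IsElemAbelianP2 p C ∧ a ∈ C ∧ b ∈ C := by
  have := Fact.mk hp
  have hoa : orderOf a = p := orderOf_eq_prime (hexp a) ha
  have hb1 : b ≠ 1 := fun h => hb (h ▸ one_mem _)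
  have hob : orderOf b = p := orderOf_eq_prime (hexp b) hb1
  have hcomm : ∀ (x : Subgroup.zpowers a) (y : Subgroup.zpowers b),
      Commute ((Subgroup.zpowers a).subtype x) ((Subgroup.zpowers b).subtype y) := by
    rintro ⟨_, i, rfl⟩ ⟨_, j, rfl⟩
    exact hab.zpow_zpow i j
  have hdisj : Disjoint (Subgroup.zpowers a) (Subgroup.zpowers b) := by
    rw [Subgroup.disjoint_def]
    intro x hxa hxb
    by_contra hx
    have hox : orderOf x = p := orderOf_eq_prime (hexp x) hx
    have : Finite (Subgroup.zpowers b) :=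
      Nat.finite_of_card_ne_zero (by rw [Nat.card_zpowers, hob]; exact hp.ne_zero)
    have h : Subgroup.zpowers x = Subgroup.zpowers b :=
      Subgroup.eq_of_le_of_card_ge (Subgroup.zpowers_le.2 hxb)
        (by rw [Nat.card_zpowers, Nat.card_zpowers, hox, hob])
    exact hb (Subgroup.zpowers_le.2 hxa (h ▸ Subgroup.mem_zpowers b))
  set φ := MonoidHom.noncommCoprod (Subgroup.zpowers a).subtype (Subgroup.zpowers b).subtype hcomm
    with hφ
  have hinj : Function.Injective φ := by
    rw [hφ, MonoidHom.noncommCoprod_injective]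
    exact ⟨Subgroup.subtype_injective _, Subgroup.subtype_injective _, by simpa using hdisj⟩
  refine ⟨φ.range, ⟨?_, fun x _ => hexp x, ?_⟩, ⟨(⟨a, Subgroup.mem_zpowers a⟩, 1), by simp [hφ]⟩,
    ⟨(1, ⟨b, Subgroup.mem_zpowers b⟩), by simp [hφ]⟩⟩
  · rw [← Nat.card_congr (MonoidHom.ofInjective hinj).toEquiv, Nat.card_prod, Nat.card_zpowers,
      Nat.card_zpowers, hoa, hob, sq]
  · rintro _ ⟨x, rfl⟩ _ ⟨y, rfl⟩
    rw [← map_mul, ← map_mul]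
    exact congrArg φ (Prod.ext
      (Subtype.ext (setLike_mul_comm x.1.2 y.1.2))
      (Subtype.ext (setLike_mul_comm x.2.2 y.2.2)))

/-- Two distinct elementary abelian subgroups of order `p ^ 2` meet in the cyclic subgroup
generated by any common nontrivial element. -/
theorem inf_eq_zpowers_of_isElemAbelianP2 {G : Type*} [Group G] [Finite G] {p : ℕ}
    (hp : p.Prime) {C D : Subgroup G} (hC : IsElemAbelianP2 p C) (hD : IsElemAbelianP2 p D)
    (hDC : ¬ D ≤ C) {a : G} (ha : a ≠ 1) (haC : a ∈ C) (haD : a ∈ D) :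
    C ⊓ D = Subgroup.zpowers a := by
  have := Fact.mk hp
  have hoa : orderOf a = p := orderOf_eq_prime (hC.2.1 a haC) ha
  have hdvd : Nat.card (C ⊓ D : Subgroup G) ∣ p ^ 2 :=
    hC.1 ▸ Subgroup.card_dvd_of_le inf_le_left
  obtain ⟨i, hi, hcard⟩ := (Nat.dvd_prime_pow hp).1 hdvd
  have hi2 : i ≠ 2 := by
    rintro rfl
    have h : C ⊓ D = D :=
      Subgroup.eq_of_le_of_card_ge inf_le_right (by rw [hcard, hD.1])
    exact hDC (inf_eq_right.1 h)
  refine (Subgroup.eq_of_le_of_card_ge (Subgroup.zpowers_le.2 (Subgroup.mem_inf.2 ⟨haC, haD⟩)) ?_).symm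
  rw [Nat.card_zpowers, hoa, hcard]
  calc p ^ i ≤ p ^ 1 := Nat.pow_le_pow_right hp.pos (by omega)
    _ = p := pow_one p

theorem exists_mem_notMem_of_card_lt {G : Type*} [Group G] [Finite G] {H K : Subgroup G}
    (h : Nat.card K < Nat.card H) : ∃ x ∈ H, x ∉ K := by
  by_contra! hle
  exact absurd (Subgroup.card_le_of_le (H := H) (K := K) hle) (by omega)

/-- A function that is multiplicative on a subgroup respects powers of its elements. -/
theorem map_pow_of_mul_on {G : Type*} [Group G] {C : Subgroup G} {f : G → G}
    (hf : ∀ u ∈ C, ∀ v ∈ C, f (u * v) = f u * f v) {x : G} (hx : x ∈ C) (n : ℕ) :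
    f (x ^ n) = f x ^ n := by
  induction n with
  | zero => simpa using hf 1 C.one_mem 1 C.one_mem
  | succ n ih => rw [pow_succ, hf _ (C.pow_mem hx n) _ hx, ih, pow_succ]

/-- If `a` is not a power of `z`, both have exponent `p` and `a ^ n * z ^ n = a ^ m * z ^ k`
with `a` and `z` commuting, then `a ^ m = a ^ k`. -/
theorem pow_eq_of_mul_pow_eq {G : Type*} [Group G] {p : ℕ} (hp : p.Prime)
    (hexp : ∀ g : G, g ^ p = 1) {a z : G} (hz : z ≠ 1) (haz : a ∉ Subgroup.zpowers z)
    {k m n : ℕ} (h : a ^ n * z ^ n = a ^ m * z ^ k) : a ^ m = a ^ k := by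
  have := Fact.mk hp
  have ha : a ≠ 1 := fun h => haz (h ▸ one_mem _)
  have hoa : orderOf a = p := orderOf_eq_prime (hexp a) ha
  have hoz : orderOf z = p := orderOf_eq_prime (hexp z) hz
  have hmem : (a ^ m)⁻¹ * a ^ n ∈ Subgroup.zpowers z := by
    have h' : (a ^ m)⁻¹ * a ^ n = z ^ k * (z ^ n)⁻¹ := by
      rw [eq_mul_inv_iff_mul_eq, mul_assoc, h, inv_mul_cancel_left]
    rw [h']
    exact mul_mem (Subgroup.npow_mem_zpowers z k) (inv_mem (Subgroup.npow_mem_zpowers z n))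
  have hnm : a ^ m = a ^ n := by
    by_contra hne
    have hx : (a ^ m)⁻¹ * a ^ n ≠ 1 := fun h => hne (inv_mul_eq_one.1 h)
    have hox := orderOf_eq_prime (hexp ((a ^ m)⁻¹ * a ^ n)) hx
    have : Finite (Subgroup.zpowers a) :=
      Nat.finite_of_card_ne_zero (by rw [Nat.card_zpowers, hoa]; exact hp.ne_zero)
    have heq : Subgroup.zpowers ((a ^ m)⁻¹ * a ^ n) = Subgroup.zpowers a :=
      Subgroup.eq_of_le_of_card_ge
        (Subgroup.zpowers_le.2 (mul_mem (inv_mem (Subgroup.npow_mem_zpowers a m))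
          (Subgroup.npow_mem_zpowers a n)))
        (by rw [Nat.card_zpowers, Nat.card_zpowers, hox, hoa])
    exact haz (Subgroup.zpowers_le.2 hmem (heq ▸ Subgroup.mem_zpowers a))
  rw [hnm] at h ⊢
  have hzz := mul_left_cancel h
  rw [pow_inj_mod, hoz] at hzz
  rw [pow_inj_mod, hoa, hzz]

theorem stmt13 {G : Type*} [Group G] [Finite G] [Nontrivial G]
    (p : ℕ) (hp : p.Prime) (hG : IsPGroup p G)
    (hexp : ∀ g : G, g ^ p = 1)
    (hcent : ∀ a : G, p ^ 3 ≤ Nat.card ↥(Subgroup.centralizer ({a} : Set G))) :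
    ∃ 𝒞 : Set (Subgroup G), IsStarCover p 𝒞 ∧
      (∀ lam : ℕ, lam < p → InRC 𝒞 (fun g : G => g ^ lam)) ∧
      (∀ f : G → G, InRC 𝒞 f →
        ∃! lam : ℕ, lam < p ∧ f = fun g : G => g ^ lam) := by
  have := Fact.mk hp
  have horder : ∀ a : G, a ≠ 1 → orderOf a = p := fun a ha => orderOf_eq_prime (hexp a) ha
  have hcell : ∀ a : G, a ≠ 1 → ∃ C, IsElemAbelianP2 p C ∧ a ∈ C := by
    intro a ha
    obtain ⟨b, hb, hba⟩ := exists_mem_notMem_of_card_lt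
      (H := Subgroup.centralizer {a}) (K := Subgroup.zpowers a) (by
        rw [Nat.card_zpowers, horder a ha]
        exact lt_of_lt_of_le (lt_self_pow₀ hp.one_lt (by norm_num)) (hcent a))
    obtain ⟨C, hC, haC, -⟩ := exists_isElemAbelianP2 hp hexp ha
      (Subgroup.mem_centralizer_singleton_iff.1 hb).symm hba
    exact ⟨C, hC, haC⟩
  have := hG.center_nontrivial
  obtain ⟨⟨z, hzc⟩, hz⟩ := exists_ne (1 : Subgroup.center G)
  have hz1 : z ≠ 1 := fun h => hz (Subtype.ext h)
  refine ⟨{C | IsElemAbelianP2 p C}, ⟨fun g => ?_, fun C hC => Or.inr hC⟩, ?_, ?_⟩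
  · by_cases hg : g = 1
    · obtain ⟨C, hC, -⟩ := hcell z hz1
      exact ⟨C, hC, hg ▸ C.one_mem⟩
    · exact hcell g hg
  · intro lam _ C hC
    refine ⟨fun x hx => C.pow_mem hx lam, fun u hu v hv => ?_⟩
    exact (show Commute u v from hC.2.2 u hu v hv).mul_pow lam
  intro f hf
  have heigen : ∀ a : G, ∃ k : ℕ, f a = a ^ k := by
    intro a
    by_cases ha : a = 1
    · obtain ⟨C, hC, -⟩ := hcell z hz1
      exact ⟨0, by simpa [ha] using (hf C hC).2 1 C.one_mem 1 C.one_mem⟩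
    obtain ⟨C, hC, haC⟩ := hcell a ha
    obtain ⟨c, hc, hcC⟩ := exists_mem_notMem_of_card_lt
      (H := Subgroup.centralizer {a}) (K := C) (by
        rw [hC.1]
        exact lt_of_lt_of_le (Nat.pow_lt_pow_right hp.one_lt (by norm_num)) (hcent a))
    obtain ⟨D, hD, haD, hcD⟩ := exists_isElemAbelianP2 hp hexp ha
      (Subgroup.mem_centralizer_singleton_iff.1 hc).symm
      (fun h => hcC (Subgroup.zpowers_le.2 haC h))
    have hfa : f a ∈ C ⊓ D := ⟨(hf C hC).1 a haC, (hf D hD).1 a haD⟩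
    rw [inf_eq_zpowers_of_isElemAbelianP2 hp hC hD (fun h => hcC (h hcD)) ha haC haD,
      ← mem_powers_iff_mem_zpowers] at hfa
    obtain ⟨k, hk⟩ := hfa
    exact ⟨k, hk.symm⟩
  obtain ⟨k, hk⟩ := heigen z
  have hall : ∀ a : G, f a = a ^ k := by
    intro a
    by_cases haz : a ∈ Subgroup.zpowers z
    · rw [← mem_powers_iff_mem_zpowers] at haz
      obtain ⟨j, rfl⟩ := haz
      obtain ⟨C, hC, hzC⟩ := hcell z hz1
      have h := map_pow_of_mul_on (hf C hC).2 hzC j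
      rw [hk, pow_right_comm] at h
      exact h
    · have hcomm : Commute z a := (Subgroup.mem_center_iff.1 hzc a).symm
      obtain ⟨C, hC, hzC, haC⟩ := exists_isElemAbelianP2 hp hexp hz1 hcomm haz
      obtain ⟨m, hm⟩ := heigen a
      obtain ⟨n, hn⟩ := heigen (a * z)
      have h := (hf C hC).2 a haC z hzC
      rw [hn, hm, hk, hcomm.symm.mul_pow] at h
      rw [hm]
      exact pow_eq_of_mul_pow_eq hp hexp hz1 haz h
  refine ⟨k % p, ⟨Nat.mod_lt _ hp.pos, ?_⟩, ?_⟩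
  · funext a
    rw [hall a, pow_eq_pow_mod k (hexp a)]
  · rintro l ⟨hl, hfl⟩
    have h : z ^ l = z ^ k := by rw [← hall z, hfl]
    rw [pow_inj_mod, horder z hz1, Nat.mod_eq_of_lt hl] at h
    exact h
end
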